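/- arXiv:1709.04437 — 3 statements merged into one kernel-verified Lean document; each statement's English description precedes it below -/
import Mathlib

section
/- Let G be a simple graph on a finite vertex set V, let w assign to each edge of G a strictly positive real weight, and let {a,b} be an edge of G. Then there is no vertex q for which both of the following hold: some weight-minimal path from q to a contains the edge {a,b}, and some weight-minimal path from q to b contains the edge {a,b}. (This is Lemma 1 of the paper: with A denoting the set of vertices having a weight-minimal path to a that uses the edge {a,b}, and B the analogous set for b, the sets A and B are disjoint.) -/
open scoped ENNReal

/-- The weight of a walk: the sum of the weights of its edges, counted with multiplicity. -/
def walkWeight {V : Type*} {G : SimpleGraph V} (w : Sym2 V → ℝ) {x y : V}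
    (p : G.Walk x y) : ℝ :=
  (p.edges.map w).sum

/-- A walk from `x` to `y` is weight-minimal if its weight is at most the weight of
every walk from `x` to `y`. -/
def IsWeightMinimal {V : Type*} {G : SimpleGraph V} (w : Sym2 V → ℝ) {x y : V}
    (p : G.Walk x y) : Prop :=
  ∀ q : G.Walk x y, walkWeight w p ≤ walkWeight w q

theorem walkWeight_nonneg {V : Type*} {G : SimpleGraph V} {w : Sym2 V → ℝ}
    (hw : ∀ e ∈ G.edgeSet, 0 ≤ w e) {x y : V} (p : G.Walk x y) : 0 ≤ walkWeight w p := by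
  refine List.sum_nonneg fun c hc => ?_
  obtain ⟨e, he, rfl⟩ := List.mem_map.1 hc
  exact hw e (p.edges_subset_edgeSet he)

theorem walkWeight_cons {V : Type*} {G : SimpleGraph V} (w : Sym2 V → ℝ) {x y z : V}
    (h : G.Adj x y) (p : G.Walk y z) :
    walkWeight w (SimpleGraph.Walk.cons h p) = w s(x, y) + walkWeight w p := by
  simp [walkWeight]

/-- The part of a walk before its first traversal of an edge `{a,b}` ends at `a` or at `b`, and
its weight together with that of the edge is at most the weight of the walk. -/
theorem exists_walk_weight_add_le_of_mem_edges {V : Type*} {G : SimpleGraph V} {w : Sym2 V → ℝ}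
    (hw : ∀ e ∈ G.edgeSet, 0 ≤ w e) {a b x y : V} (p : G.Walk x y) (hp : s(a, b) ∈ p.edges) :
    (∃ r : G.Walk x a, walkWeight w r + w s(a, b) ≤ walkWeight w p) ∨
      ∃ r : G.Walk x b, walkWeight w r + w s(a, b) ≤ walkWeight w p := by
  induction p with
  | nil => simp at hp
  | @cons u v t h p ih =>
    have hnil : ∀ c : V, walkWeight w (SimpleGraph.Walk.nil : G.Walk c c) = 0 := fun c => by
      simp [walkWeight]
    rw [SimpleGraph.Walk.edges_cons, List.mem_cons] at hp
    rcases hp with he | hp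
    · have hnonneg := walkWeight_nonneg hw p
      rw [walkWeight_cons, he]
      rcases Sym2.eq_iff.1 he with ⟨rfl, rfl⟩ | ⟨rfl, rfl⟩
      · exact Or.inl ⟨.nil, by linarith [hnil a]⟩
      · exact Or.inr ⟨.nil, by linarith [hnil b]⟩
    · rw [walkWeight_cons]
      refine (ih hp).imp ?_ ?_ <;>
      · rintro ⟨r, hr⟩
        exact ⟨.cons h r, by rw [walkWeight_cons]; linarith⟩

/-- **Lemma 1.** In a simple graph on a finite vertex set with strictly positive edge weights,
for an edge `{a,b}` there is no vertex `q` having both a weight-minimal path to `a`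
containing `{a,b}` and a weight-minimal path to `b` containing `{a,b}`
(i.e. the sets `A` and `B` are disjoint). -/
theorem lemma1_A_B_disjoint {V : Type*} [Fintype V] (G : SimpleGraph V)
    (w : Sym2 V → ℝ) (hw : ∀ e ∈ G.edgeSet, 0 < w e)
    (a b : V) (hab : G.Adj a b) :
    ¬ ∃ q : V,
      (∃ p : G.Walk q a, p.IsPath ∧ IsWeightMinimal w p ∧ s(a, b) ∈ p.edges) ∧
      (∃ p : G.Walk q b, p.IsPath ∧ IsWeightMinimal w p ∧ s(a, b) ∈ p.edges) := by
  rintro ⟨q, ⟨p, -, hp, hpe⟩, ⟨p', -, hp', hpe'⟩⟩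
  have h0 := hw s(a, b) hab
  have hle : ∀ e ∈ G.edgeSet, 0 ≤ w e := fun e he => (hw e he).le
  have h1 : ∃ r : G.Walk q b, walkWeight w r + w s(a, b) ≤ walkWeight w p := by
    rcases exists_walk_weight_add_le_of_mem_edges hle p hpe with ⟨r, hr⟩ | h
    · linarith [hp r]
    · exact h
  have h2 : ∃ r : G.Walk q a, walkWeight w r + w s(a, b) ≤ walkWeight w p' := by
    rcases exists_walk_weight_add_le_of_mem_edges hle p' hpe' with h | ⟨r, hr⟩
    · exact h
    · linarith [hp' r]
  obtain ⟨r, hr⟩ := h1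
  obtain ⟨r', hr'⟩ := h2
  linarith [hp r', hp' r]
end

section
/- Let G be a simple graph on a finite vertex set V and let w assign to each edge of G a strictly positive real weight. For every path P from a vertex i to a vertex j, there exists a path Q from i to j such that: (1) the weight of Q is at most the weight of P; (2) the maximum edge weight occurring on Q is at most the maximum edge weight occurring on P; and (3) Q is weight-minimal among all paths from i to j whose maximum edge weight is at most the maximum edge weight of Q. (This expresses the paper's claim that the dynamic programming algorithm, which for each threshold graph G_h records a shortest i–j path, computes the complete Pareto front of i–j paths with respect to the two metrics total path length and maximum link distance.) -/
open scoped ENNReal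

/-- The maximum edge weight occurring on a walk (`⊥` for the empty walk). -/
noncomputable def maxEdgeWeight {V : Type*} {G : SimpleGraph V} (w : Sym2 V → ℝ) {x y : V}
    (p : G.Walk x y) : WithBot ℝ :=
  (p.edges.map w).maximum

/-- **Pareto front.** For every path `P` from `i` to `j` there is a path `Q` from `i` to `j`
whose weight is at most that of `P`, whose maximum edge weight is at most that of `P`,
and which is weight-minimal among all `i`–`j` paths whose maximum edge weight is at most
the maximum edge weight of `Q`. -/
theorem pareto_front_exists {V : Type*} [Fintype V] (G : SimpleGraph V)
    (w : Sym2 V → ℝ) (hw : ∀ e ∈ G.edgeSet, 0 < w e)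
    (i j : V) (P : G.Walk i j) (hP : P.IsPath) :
    ∃ Q : G.Walk i j, Q.IsPath ∧
      walkWeight w Q ≤ walkWeight w P ∧
      maxEdgeWeight w Q ≤ maxEdgeWeight w P ∧
      ∀ R : G.Walk i j, R.IsPath → maxEdgeWeight w R ≤ maxEdgeWeight w Q →
        walkWeight w Q ≤ walkWeight w R := by
  classical
  have hfin : {Q : G.Walk i j | Q.IsPath ∧ maxEdgeWeight w Q ≤ maxEdgeWeight w P}.Finite :=
    (Set.finite_coe_iff.1 (inferInstanceAs (Finite (G.Path i j)))).subset fun _ hQ => hQ.1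
  obtain ⟨Q, ⟨hQ, hQP⟩, hmin⟩ := Set.exists_min_image _ (walkWeight w) hfin ⟨P, hP, le_rfl⟩
  exact ⟨Q, hQ, hmin P ⟨hP, le_rfl⟩, hQP, fun R hR hRQ => hmin R ⟨hR, hRQ.trans hQP⟩⟩
end

section
/- Let G be a simple graph on a finite vertex set V, let w assign to each edge of G a strictly positive real weight, let e = {a,b} be an edge of G, and let G' be the graph obtained from G by deleting e. Define A as the set of vertices having a weight-minimal path in G to a that contains the edge e, and B as the set of vertices having a weight-minimal path in G to b that contains e. If for vertices i and j it is not the case that (i ∈ A and j ∈ B), and also not the case that (i ∈ B and j ∈ A), then dist_G(i,j) = dist_{G'}(i,j), i.e., deleting the edge e does not change the weighted distance between i and j. (This justifies the paper's optimization of checking only vertex pairs in A × B when the edge ℓ_h is added in iteration h of the algorithm.) -/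
open scoped ENNReal

/-- The weighted distance between two vertices: the infimum, in the extended nonnegative
reals, of the weights of all connecting walks (`∞` when no walk exists). -/
noncomputable def wdist {V : Type*} (G : SimpleGraph V) (w : Sym2 V → ℝ) (x y : V) : ℝ≥0∞ :=
  ⨅ p : G.Walk x y, ENNReal.ofReal (walkWeight w p)

theorem walkWeight_append {V : Type*} {G : SimpleGraph V} (w : Sym2 V → ℝ) {x y z : V}
    (p : G.Walk x y) (q : G.Walk y z) :
    walkWeight w (p.append q) = walkWeight w p + walkWeight w q := by
  simp [walkWeight]

theorem walkWeight_reverse {V : Type*} {G : SimpleGraph V} (w : Sym2 V → ℝ) {x y : V}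
    (p : G.Walk x y) : walkWeight w p.reverse = walkWeight w p := by
  simp [walkWeight, List.sum_reverse]

theorem IsWeightMinimal.reverse {V : Type*} {G : SimpleGraph V} {w : Sym2 V → ℝ} {x y : V}
    {p : G.Walk x y} (hp : IsWeightMinimal w p) : IsWeightMinimal w p.reverse := fun q => by
  simpa only [walkWeight_reverse] using hp q.reverse

theorem IsWeightMinimal.of_append_left {V : Type*} {G : SimpleGraph V} {w : Sym2 V → ℝ}
    {x y z : V} {p : G.Walk x y} {q : G.Walk y z} (h : IsWeightMinimal w (p.append q)) :
    IsWeightMinimal w p := fun r => by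
  simpa [walkWeight_append] using h (r.append q)

theorem IsWeightMinimal.of_append_right {V : Type*} {G : SimpleGraph V} {w : Sym2 V → ℝ}
    {x y z : V} {p : G.Walk x y} {q : G.Walk y z} (h : IsWeightMinimal w (p.append q)) :
    IsWeightMinimal w q := fun r => by
  simpa [walkWeight_append] using h (p.append r)

theorem walkWeight_bypass_le {V : Type*} [DecidableEq V] {G : SimpleGraph V} {w : Sym2 V → ℝ}
    (hw : ∀ e ∈ G.edgeSet, 0 ≤ w e) {x y : V} (p : G.Walk x y) :
    walkWeight w p.bypass ≤ walkWeight w p := by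
  refine (p.edges_bypass_sublist_edges.map w).sum_le_sum fun r hr => ?_
  obtain ⟨e, he, rfl⟩ := List.mem_map.1 hr
  exact hw e (p.edges_subset_edgeSet he)

/-- In a finite graph with nonnegative edge weights, any two connected vertices are joined by
a weight-minimal path. -/
theorem exists_isPath_isWeightMinimal {V : Type*} [Finite V] {G : SimpleGraph V}
    {w : Sym2 V → ℝ} (hw : ∀ e ∈ G.edgeSet, 0 ≤ w e) {x y : V} (h : G.Reachable x y) :
    ∃ p : G.Walk x y, p.IsPath ∧ IsWeightMinimal w p := by
  classical
  have := Fintype.ofFinite V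
  obtain ⟨p₀⟩ := h
  have : Nonempty (G.Path x y) := ⟨p₀.toPath⟩
  obtain ⟨p, hp⟩ := Finite.exists_min fun p : G.Path x y => walkWeight w (p : G.Walk x y)
  exact ⟨p, p.2, fun q => (hp q.toPath).trans (walkWeight_bypass_le hw q)⟩

theorem exists_eq_append_cons_of_mem_edges {V : Type*} {G : SimpleGraph V} {a b x y : V}
    (p : G.Walk x y) (h : s(a, b) ∈ p.edges) :
    (∃ (hab : G.Adj a b) (q : G.Walk x a) (r : G.Walk b y),
      p = q.append (SimpleGraph.Walk.cons hab r)) ∨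
    (∃ (hba : G.Adj b a) (q : G.Walk x b) (r : G.Walk a y),
      p = q.append (SimpleGraph.Walk.cons hba r)) := by
  induction p with
  | nil => simp at h
  | cons hadj p ih =>
    rw [SimpleGraph.Walk.edges_cons, List.mem_cons] at h
    rcases h with h | h
    · rcases Sym2.eq_iff.1 h with ⟨rfl, rfl⟩ | ⟨rfl, rfl⟩
      · exact .inl ⟨hadj, .nil, p, rfl⟩
      · exact .inr ⟨hadj, .nil, p, rfl⟩
    · rcases ih h with ⟨hab, q, r, rfl⟩ | ⟨hba, q, r, rfl⟩
      · exact .inl ⟨hab, .cons hadj q, r, rfl⟩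
      · exact .inr ⟨hba, .cons hadj q, r, rfl⟩

/-- If a weight-minimal path from `x` to `y` crosses the edge `uv` from `u` to `v`, then `x` has
a weight-minimal path to `v`, and `y` one to `u`, through that edge. -/
theorem exists_isWeightMinimal_of_append_cons {V : Type*} {G : SimpleGraph V} {w : Sym2 V → ℝ}
    {x y u v : V} (huv : G.Adj u v) (q : G.Walk x u) (r : G.Walk v y)
    (hp : (q.append (SimpleGraph.Walk.cons huv r)).IsPath)
    (hm : IsWeightMinimal w (q.append (SimpleGraph.Walk.cons huv r))) :
    (∃ p : G.Walk x v, p.IsPath ∧ IsWeightMinimal w p ∧ s(u, v) ∈ p.edges) ∧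
    (∃ p : G.Walk y u, p.IsPath ∧ IsWeightMinimal w p ∧ s(u, v) ∈ p.edges) := by
  have heq : q.append (SimpleGraph.Walk.cons huv r) = (q.concat huv).append r :=
    (SimpleGraph.Walk.concat_append q huv r).symm
  refine ⟨⟨q.concat huv, ?_, ?_, by simp⟩, ⟨(SimpleGraph.Walk.cons huv r).reverse,
    hp.of_append_right.reverse, hm.of_append_right.reverse, by simp⟩⟩
  · rw [heq] at hp
    exact hp.of_append_left
  · rw [heq] at hm
    exact hm.of_append_left

theorem wdist_anti {V : Type*} {G H : SimpleGraph V} (h : H ≤ G) (w : Sym2 V → ℝ) (x y : V) :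
    wdist G w x y ≤ wdist H w x y :=
  le_iInf fun p => (iInf_le _ (p.mapLe h)).trans_eq (by simp [walkWeight])

/-- If it is not the case that `i ∈ A` and `j ∈ B`, nor that `i ∈ B` and `j ∈ A`
(where `A` is the set of vertices with a weight-minimal path to `a` using the edge
`{a,b}`, and `B` the analogous set for `b`), then deleting the edge `{a,b}` does not
change the weighted distance between `i` and `j`. -/
theorem deleting_edge_preserves_distance {V : Type*} [Fintype V] (G : SimpleGraph V)
    (w : Sym2 V → ℝ) (hw : ∀ e ∈ G.edgeSet, 0 < w e)
    (a b : V) (hab : G.Adj a b) (i j : V)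
    (h1 : ¬ ((∃ p : G.Walk i a, p.IsPath ∧ IsWeightMinimal w p ∧ s(a, b) ∈ p.edges) ∧
             (∃ p : G.Walk j b, p.IsPath ∧ IsWeightMinimal w p ∧ s(a, b) ∈ p.edges)))
    (h2 : ¬ ((∃ p : G.Walk i b, p.IsPath ∧ IsWeightMinimal w p ∧ s(a, b) ∈ p.edges) ∧
             (∃ p : G.Walk j a, p.IsPath ∧ IsWeightMinimal w p ∧ s(a, b) ∈ p.edges))) :
    wdist G w i j = wdist (G.deleteEdges {s(a, b)}) w i j := by
  refine le_antisymm (wdist_anti (G.deleteEdges_le _) w i j) (le_iInf fun q => ?_)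
  obtain ⟨p, hp, hm⟩ := exists_isPath_isWeightMinimal (fun e he => (hw e he).le) ⟨q⟩
  have hnot : s(a, b) ∉ p.edges := fun hmem => by
    rcases exists_eq_append_cons_of_mem_edges p hmem with ⟨hab, q, r, rfl⟩ | ⟨hba, q, r, rfl⟩
    · exact h2 (exists_isWeightMinimal_of_append_cons hab q r hp hm)
    · rw [Sym2.eq_swap] at h1
      exact h1 (exists_isWeightMinimal_of_append_cons hba q r hp hm)
  refine (iInf_le _ (p.toDeleteEdge s(a, b) hnot)).trans (ENNReal.ofReal_le_ofReal ?_)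
  simpa [walkWeight, SimpleGraph.Walk.toDeleteEdge] using hm q
end
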